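/- Let n ≥ 3, α ∈ [2,n), σ₁, σ₂ < α and p, q > 0 with pq > 1 and (n−σ₁)/(1+q) + (n−σ₂)/(1+p) > n − α. Suppose (u, v) is a pair of positive radially decreasing functions, each continuous on ℝⁿ and continuously differentiable on ℝⁿ∖{0}, such that for every x ∈ ℝⁿ the integrals ∫_{ℝⁿ} v(y)^q |x−y|^{α−n} |y|^{−σ₁} dy and ∫_{ℝⁿ} u(y)^p |x−y|^{α−n} |y|^{−σ₂} dy are finite and u(x) = ∫_{ℝⁿ} v(y)^q |x−y|^{α−n} |y|^{−σ₁} dy and v(x) = ∫_{ℝⁿ} u(y)^p |x−y|^{α−n} |y|^{−σ₂} dy. Then the four integrals ∫_{ℝⁿ} u(x)^{p+1} |x|^{−σ₂} dx, ∫_{ℝⁿ} v(x)^{q+1} |x|^{−σ₁} dx, ∫_{ℝⁿ} u(x)^p |x|^{−σ₂} |x·∇u(x)| dx and ∫_{ℝⁿ} v(x)^q |x|^{−σ₁} |x·∇v(x)| dx are all finite. -/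

import Mathlib

open MeasureTheory RealInnerProductSpace

noncomputable section

/-- `w : ℝⁿ → ℝ` is radially decreasing if `w(x) = W(‖x‖)` for some
nonincreasing `W : [0,∞) → (0,∞)`. -/
def RadiallyDecreasing {n : ℕ} (w : EuclideanSpace ℝ (Fin n) → ℝ) : Prop :=
  ∃ W : ℝ → ℝ, AntitoneOn W (Set.Ici 0) ∧ (∀ r, 0 ≤ r → 0 < W r) ∧
    ∀ x, w x = W ‖x‖

open Filter Topology Set in
/-- A bounded profile with sufficiently fast power decay has a finite weighted moment. -/
lemma integrableOn_rpow_mul_rpow_of_decay {W : ℝ → ℝ} (hc : Continuous W) (hpos : ∀ r, 0 < W r)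
    (hanti : AntitoneOn W (Ici 0)) {C a s m : ℝ} (hs : 0 < s) (hm : 0 < m) (ham : m < a * s)
    (hC : 0 < C) (hdecay : ∀ r, 0 < r → W r ≤ C * r ^ (-a)) :
    IntegrableOn (fun r => W r ^ s * r ^ (m - 1)) (Ioi 0) := by
  have hcont : ContinuousOn (fun r => W r ^ s * r ^ (m - 1)) (Ioi 0) := by
    refine ContinuousOn.mul ?_ ?_
    · exact (hc.rpow_const fun r => Or.inl (hpos r).ne').continuousOn
    · exact fun r hr => (Real.continuousAt_rpow_const r _ (Or.inl (ne_of_gt hr))).continuousWithinAt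
  have hsplit : Ioi (0 : ℝ) = Ioo 0 2 ∪ Ioi 1 := by
    ext r
    simp only [mem_Ioi, mem_union, mem_Ioo]
    grind
  rw [hsplit, integrableOn_union]
  constructor
  · have hint : IntegrableOn (fun r : ℝ => W 0 ^ s * r ^ (m - 1)) (Ioo 0 2) :=
      ((intervalIntegral.integrableOn_Ioo_rpow_iff two_pos).2 (by linarith)).const_mul _
    refine Integrable.mono' hint
      ((hcont.mono Ioo_subset_Ioi_self).aestronglyMeasurable measurableSet_Ioo) ?_
    refine (ae_restrict_iff' measurableSet_Ioo).2 (Eventually.of_forall fun r hr => ?_)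
    have h1 := Real.rpow_nonneg (hpos r).le s
    have h2 := Real.rpow_nonneg hr.1.le (m - 1)
    rw [Real.norm_of_nonneg (mul_nonneg h1 h2)]
    gcongr
    · exact (hpos r).le
    · exact hanti self_mem_Ici hr.1.le hr.1.le
  · have hint : IntegrableOn (fun r : ℝ => C ^ s * r ^ (m - 1 - a * s)) (Ioi 1) :=
      (integrableOn_Ioi_rpow_of_lt (by linarith) one_pos).const_mul _
    refine Integrable.mono' hint
      ((hcont.mono (Ioi_subset_Ioi zero_le_one)).aestronglyMeasurable measurableSet_Ioi) ?_
    refine (ae_restrict_iff' measurableSet_Ioi).2 (Eventually.of_forall fun r hr => ?_)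
    have hr0 : 0 < r := one_pos.trans hr
    have h1 := Real.rpow_nonneg (hpos r).le s
    have h2 := Real.rpow_nonneg hr0.le (m - 1)
    rw [Real.norm_of_nonneg (mul_nonneg h1 h2)]
    calc W r ^ s * r ^ (m - 1) ≤ (C * r ^ (-a)) ^ s * r ^ (m - 1) := by
          gcongr
          · exact (hpos r).le
          · exact hdecay r hr0
      _ = C ^ s * r ^ (m - 1 - a * s) := by
          rw [Real.mul_rpow hC.le (Real.rpow_nonneg hr0.le _), ← Real.rpow_mul hr0.le, mul_assoc,
            ← Real.rpow_add hr0]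
          ring_nf

open Filter Topology Set in
/-- Integrating by parts against a finite weighted moment controls the weighted derivative. -/
lemma integrableOn_rpow_mul_abs_deriv_of_decay {W : ℝ → ℝ} (hc : Continuous W)
    (hpos : ∀ r, 0 < W r) (hanti : AntitoneOn W (Ici 0))
    (hdiff : ∀ r, 0 < r → DifferentiableAt ℝ W r) {C a p m : ℝ} (hp : 0 < p) (hm : 0 < m)
    (ham : m < a * (p + 1)) (hC : 0 < C) (hdecay : ∀ r, 0 < r → W r ≤ C * r ^ (-a)) :
    IntegrableOn (fun r => W r ^ p * r ^ m * |deriv W r|) (Ioi 0) := by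
  have hmoment := integrableOn_rpow_mul_rpow_of_decay hc hpos hanti (by linarith : 0 < p + 1)
    hm ham hC hdecay
  set h : ℝ → ℝ := (Ioi (0 : ℝ)).indicator (fun r => W r ^ (p + 1) * r ^ (m - 1)) with hh
  have hint : Integrable h := (integrable_indicator_iff measurableSet_Ioi).2 hmoment
  have hcF : Continuous fun r => W r ^ (p + 1) * r ^ m :=
    (hc.rpow_const fun r => Or.inl (hpos r).ne').mul (Real.continuous_rpow_const hm.le)
  have hhcont : ContinuousOn h (Ioi 0) := by
    refine ContinuousOn.congr (f := fun r => W r ^ (p + 1) * r ^ (m - 1)) ?_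
      (fun r hr => indicator_of_mem hr _)
    refine ContinuousOn.mul ?_ ?_
    · exact (hc.rpow_const fun r => Or.inl (hpos r).ne').continuousOn
    · exact fun r hr => (Real.continuousAt_rpow_const r _ (Or.inl (ne_of_gt hr))).continuousWithinAt
  have hlim : Tendsto (fun r => W r ^ (p + 1) * r ^ m) atTop (𝓝 0) := by
    have hz : Tendsto (fun r : ℝ => C ^ (p + 1) * r ^ (-(a * (p + 1) - m))) atTop (𝓝 0) := by
      simpa using (tendsto_rpow_neg_atTop (by linarith : 0 < a * (p + 1) - m)).const_mul
        (C ^ (p + 1))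
    refine squeeze_zero' ?_ ?_ hz
    · filter_upwards [eventually_gt_atTop 0] with r hr
      exact mul_nonneg (Real.rpow_nonneg (hpos r).le _) (Real.rpow_nonneg hr.le _)
    · filter_upwards [eventually_gt_atTop 0] with r hr
      calc W r ^ (p + 1) * r ^ m ≤ (C * r ^ (-a)) ^ (p + 1) * r ^ m := by
            gcongr
            · exact (hpos r).le
            · exact hdecay r hr
        _ = C ^ (p + 1) * r ^ (-(a * (p + 1) - m)) := by
            rw [Real.mul_rpow hC.le (Real.rpow_nonneg hr.le _), ← Real.rpow_mul hr.le, mul_assoc,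
              ← Real.rpow_add hr]
            ring_nf
  have hprim : Tendsto (fun r => ∫ t in (0 : ℝ)..r, h t) atTop (𝓝 (∫ t in Ioi 0, h t)) :=
    intervalIntegral_tendsto_integral_Ioi 0 hint.integrableOn tendsto_id
  have hneg : ∀ r ∈ Ioi (0 : ℝ), deriv W r ≤ 0 := fun r hr => by
    rw [← derivWithin_of_mem_nhds (Ici_mem_nhds hr)]
    exact hanti.derivWithin_nonpos
  refine integrableOn_Ioi_deriv_of_nonneg
    (g := fun r => (m * (∫ t in (0 : ℝ)..r, h t) - W r ^ (p + 1) * r ^ m) / (p + 1))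
    (a := 0) ?_ ?_ ?_ (((hprim.const_mul m).sub hlim).div_const (p + 1))
  · have hcp := intervalIntegral.continuous_primitive
      (fun a b => hint.intervalIntegrable (a := a) (b := b)) 0
    exact (((hcp.const_mul m).sub hcF).div_const _).continuousWithinAt
  · intro r hr
    have hr0 : (0 : ℝ) < r := hr
    have d1 := intervalIntegral.integral_hasDerivAt_right (hint.intervalIntegrable (a := 0) (b := r))
      (hhcont.stronglyMeasurableAtFilter isOpen_Ioi r hr) (hhcont.continuousAt (Ioi_mem_nhds hr))
    have d2 : HasDerivAt (fun r => W r ^ (p + 1)) _ r :=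
      (hdiff r hr).hasDerivAt.rpow_const (Or.inl (hpos r).ne')
    have d3 : HasDerivAt (fun r : ℝ => r ^ m) _ r := Real.hasDerivAt_rpow_const (Or.inl hr0.ne')
    refine (((d1.const_mul m).sub (d2.mul d3)).div_const (p + 1)).congr_deriv ?_
    rw [hh, indicator_of_mem hr, abs_of_nonpos (hneg r hr), add_sub_cancel_right]
    field_simp
    ring
  · intro r hr
    exact mul_nonneg (mul_nonneg (Real.rpow_nonneg (hpos r).le _)
      (Real.rpow_nonneg (le_of_lt hr) _)) (abs_nonneg _)

/-- Finite energy integrals of a decaying radial function. -/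
lemma RadiallyDecreasing.integrable_energy {n : ℕ} (hn : 1 ≤ n)
    {w : EuclideanSpace ℝ (Fin n) → ℝ} (hrad : RadiallyDecreasing w) (hpos : ∀ x, 0 < w x)
    (hcont : Continuous w) (hdiff : DifferentiableOn ℝ w {(0 : EuclideanSpace ℝ (Fin n))}ᶜ)
    {C a p σ : ℝ} (hp : 0 < p) (hσ : σ < n) (ha : (n : ℝ) - σ < a * (p + 1)) (hC : 0 < C)
    (hdecay : ∀ x, x ≠ 0 → w x ≤ C * ‖x‖ ^ (-a)) :
    Integrable (fun x : EuclideanSpace ℝ (Fin n) => w x ^ (p + 1) * ‖x‖ ^ (-σ)) ∧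
    Integrable (fun x : EuclideanSpace ℝ (Fin n) =>
      w x ^ p * ‖x‖ ^ (-σ) * |⟪x, gradient w x⟫|) := by
  have : Nonempty (Fin n) := ⟨⟨0, hn⟩⟩
  obtain ⟨W₀, hanti₀, -, hW₀⟩ := hrad
  obtain ⟨e, he⟩ := exists_norm_eq (EuclideanSpace ℝ (Fin n)) zero_le_one
  have he0 : e ≠ 0 := by
    rintro rfl
    simp at he
  have hne : ∀ r : ℝ, 0 < r → r • e ≠ 0 := fun r hr => smul_ne_zero hr.ne' he0
  have hnorm : ∀ r : ℝ, 0 ≤ r → ‖r • e‖ = r := fun r hr => by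
    rw [norm_smul, he, mul_one, Real.norm_of_nonneg hr]
  set W : ℝ → ℝ := fun r => w (r • e) with hW
  have hwW : ∀ x, w x = W ‖x‖ := fun x => by
    simp only [hW]
    rw [hW₀, hW₀, hnorm _ (norm_nonneg x)]
  have hWc : Continuous W := hcont.comp (continuous_id.smul continuous_const)
  have hWpos : ∀ r, 0 < W r := fun r => hpos _
  have hWanti : AntitoneOn W (Set.Ici 0) := fun r hr s hs hrs => by
    simp only [hW]
    rw [hW₀, hW₀, hnorm r hr, hnorm s hs]
    exact hanti₀ hr hs hrs
  have hdiffAt : ∀ x, x ≠ 0 → DifferentiableAt ℝ w x := fun x hx =>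
    hdiff.differentiableAt (isOpen_compl_singleton.mem_nhds hx)
  have hWd : ∀ r, 0 < r → DifferentiableAt ℝ W r := fun r hr =>
    DifferentiableAt.comp r (hdiffAt _ (hne r hr)) (by fun_prop)
  have hWdecay : ∀ r, 0 < r → W r ≤ C * r ^ (-a) := fun r hr => by
    simpa only [hnorm r hr.le] using hdecay _ (hne r hr)
  have hm : 0 < (n : ℝ) - σ := by linarith
  have hgrad : ∀ x, ⟪x, gradient w x⟫ = ‖x‖ * deriv W ‖x‖ := fun x => by
    rcases eq_or_ne x 0 with rfl | hx
    · simp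
    have hx0 : 0 < ‖x‖ := norm_pos_iff.2 hx
    rw [real_inner_comm, inner_gradient_left]
    have hγ : HasDerivAt (fun t : ℝ => t • x) x 1 := by
      simpa using (hasDerivAt_id (1 : ℝ)).smul_const x
    have hw1 : HasFDerivAt w (fderiv ℝ w x) ((1 : ℝ) • x) := by
      rw [one_smul]
      exact (hdiffAt x hx).hasFDerivAt
    have h1 : HasDerivAt (fun t : ℝ => w (t • x)) (fderiv ℝ w x x) 1 :=
      hw1.comp_hasDerivAt (1 : ℝ) hγ
    have hγ2 : HasDerivAt (fun t : ℝ => t * ‖x‖) ‖x‖ 1 := by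
      simpa using (hasDerivAt_id (1 : ℝ)).mul_const ‖x‖
    have hW1 : HasDerivAt W (deriv W ‖x‖) (1 * ‖x‖) := by
      rw [one_mul]
      exact (hWd _ hx0).hasDerivAt
    have h2 : HasDerivAt (fun t : ℝ => W (t * ‖x‖)) (deriv W ‖x‖ * ‖x‖) 1 :=
      HasDerivAt.comp (h₂ := W) (1 : ℝ) hW1 hγ2
    have h3 : (fun t : ℝ => w (t • x)) =ᶠ[nhds 1] fun t => W (t * ‖x‖) := by
      filter_upwards [Ioi_mem_nhds (zero_lt_one : (0 : ℝ) < 1)] with t ht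
      rw [hwW, norm_smul, Real.norm_of_nonneg (le_of_lt ht)]
    rw [h1.unique (h2.congr_of_eventuallyEq h3), mul_comm]
  have hpow : ∀ r : ℝ, 0 < r → r ^ (n - 1) * r ^ (-σ) = r ^ ((n : ℝ) - σ - 1) := fun r hr => by
    rw [← Real.rpow_natCast, ← Real.rpow_add hr, Nat.cast_sub hn]
    congr 1
    push_cast
    ring
  constructor
  · simp only [hwW]
    rw [integrable_fun_norm_addHaar volume (f := fun r : ℝ => W r ^ (p + 1) * r ^ (-σ)),
      finrank_euclideanSpace_fin]
    refine (integrableOn_rpow_mul_rpow_of_decay hWc hWpos hWanti (by linarith : 0 < p + 1)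
      hm ha hC hWdecay).congr_fun (fun r hr => ?_) measurableSet_Ioi
    simp only [smul_eq_mul]
    rw [← hpow r hr]
    ring
  · simp only [hgrad]
    simp only [hwW]
    rw [integrable_fun_norm_addHaar volume
      (f := fun r : ℝ => W r ^ p * r ^ (-σ) * |r * deriv W r|), finrank_euclideanSpace_fin]
    refine (integrableOn_rpow_mul_abs_deriv_of_decay hWc hWpos hWanti hWd hp
      hm ha hC hWdecay).congr_fun (fun r hr => ?_) measurableSet_Ioi
    have hr0 : (0 : ℝ) < r := hr
    have hr1 : r ^ ((n : ℝ) - σ) = r ^ ((n : ℝ) - σ - 1) * r := by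
      rw [← Real.rpow_add_one hr0.ne', sub_add_cancel]
    simp only [smul_eq_mul]
    rw [hr1, ← hpow r hr, abs_mul, abs_of_pos hr0]
    ring

/-- The Riesz potential of a weighted power of a radially decreasing function is bounded below by
the contribution of a ball close to the evaluation point. -/
lemma exists_riesz_potential_lower_bound {n : ℕ} (hn : 1 ≤ n) (α σ q : ℝ) (hαn : α < n)
    (hq : 0 < q) : ∃ c : ℝ, 0 < c ∧ ∀ v : EuclideanSpace ℝ (Fin n) → ℝ, (∀ x, 0 < v x) →
      RadiallyDecreasing v → ∀ x, x ≠ 0 →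
      Integrable (fun y => v y ^ q * ‖x - y‖ ^ (α - (n : ℝ)) * ‖y‖ ^ (-σ)) →
      c * v x ^ q * ‖x‖ ^ (α - σ) ≤
        ∫ y, v y ^ q * ‖x - y‖ ^ (α - (n : ℝ)) * ‖y‖ ^ (-σ) := by
  have : Nonempty (Fin n) := ⟨⟨0, hn⟩⟩
  set κ : ℝ := volume.real (Metric.ball (0 : EuclideanSpace ℝ (Fin n)) 1) with hκ
  have hκpos : 0 < κ := ENNReal.toReal_pos (Metric.measure_ball_pos _ _ one_pos).ne'
    measure_ball_lt_top.ne
  refine ⟨2 ^ (-|σ|) * (1 / 4) ^ n * κ, by positivity, ?_⟩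
  rintro v hvpos ⟨V, hanti, -, hV⟩ x hx hint
  set R := ‖x‖ with hR
  have hR0 : 0 < R := norm_pos_iff.2 hx
  set B := Metric.ball ((3 / 4 : ℝ) • x) (R / 4) with hB
  have hvol : volume.real B = (R / 4) ^ n * κ := by
    rw [hκ, Measure.real, Measure.real, Measure.addHaar_ball volume _ (by positivity),
      ENNReal.toReal_mul, finrank_euclideanSpace_fin, ENNReal.toReal_ofReal (by positivity)]
  have hnn : ∀ y, 0 ≤ v y ^ q * ‖x - y‖ ^ (α - (n : ℝ)) * ‖y‖ ^ (-σ) := fun y => by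
    have := (hvpos y).le
    positivity
  have hlow : ∀ y ∈ B \ {x}, v x ^ q * R ^ (α - (n : ℝ)) * (2 ^ (-|σ|) * R ^ (-σ)) ≤
      v y ^ q * ‖x - y‖ ^ (α - (n : ℝ)) * ‖y‖ ^ (-σ) := by
    rintro y ⟨hy, hyx⟩
    have hd : ‖y - (3 / 4 : ℝ) • x‖ < R / 4 := by
      rwa [hB, Metric.mem_ball, dist_eq_norm] at hy
    have h34 : ‖(3 / 4 : ℝ) • x‖ = 3 / 4 * R := by
      rw [norm_smul, Real.norm_of_nonneg (by norm_num)]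
    have h14 : ‖(1 / 4 : ℝ) • x‖ = 1 / 4 * R := by
      rw [norm_smul, Real.norm_of_nonneg (by norm_num)]
    have hyR : ‖y‖ ≤ R := by
      have := norm_sub_norm_le y ((3 / 4 : ℝ) • x)
      linarith
    have hyR2 : R / 2 ≤ ‖y‖ := by
      have := norm_sub_norm_le ((3 / 4 : ℝ) • x) y
      rw [norm_sub_rev] at this
      linarith
    have hy0 : 0 < ‖y‖ := by linarith
    have hxy : ‖x - y‖ ≤ R := by
      have he : x - y = (1 / 4 : ℝ) • x - (y - (3 / 4 : ℝ) • x) := by module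
      rw [he]
      have := norm_sub_le ((1 / 4 : ℝ) • x) (y - (3 / 4 : ℝ) • x)
      linarith
    have hxy0 : 0 < ‖x - y‖ := norm_pos_iff.2 (sub_ne_zero.2 (Ne.symm hyx))
    have hvv : v x ≤ v y := by
      rw [hV, hV]
      exact hanti (norm_nonneg y) (norm_nonneg x) hyR
    have hweight : 2 ^ (-|σ|) * R ^ (-σ) ≤ ‖y‖ ^ (-σ) := by
      rcases le_total 0 σ with h | h
      · calc (2 : ℝ) ^ (-|σ|) * R ^ (-σ) ≤ 1 * R ^ (-σ) := by
              gcongr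
              exact Real.rpow_le_one_of_one_le_of_nonpos one_le_two (by simp)
          _ ≤ ‖y‖ ^ (-σ) := by
              rw [one_mul]
              exact Real.rpow_le_rpow_of_nonpos hy0 hyR (by linarith)
      · calc (2 : ℝ) ^ (-|σ|) * R ^ (-σ) = (R / 2) ^ (-σ) := by
              rw [abs_of_nonpos h, Real.div_rpow hR0.le two_pos.le, Real.rpow_neg two_pos.le,
                div_eq_mul_inv, mul_comm]
          _ ≤ ‖y‖ ^ (-σ) := Real.rpow_le_rpow (by positivity) hyR2 (by linarith)
    have hker : R ^ (α - (n : ℝ)) ≤ ‖x - y‖ ^ (α - (n : ℝ)) :=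
      Real.rpow_le_rpow_of_nonpos hxy0 hxy (by linarith)
    have hvx := (hvpos x).le
    have hvy := (hvpos y).le
    gcongr
  have hxB : volume.real (B \ {x}) = volume.real B := by
    simp only [Measure.real]
    rw [measure_sdiff_null (measure_singleton x)]
  have hBfin : volume (B \ {x}) ≠ ⊤ :=
    ((measure_mono Set.sdiff_subset).trans_lt measure_ball_lt_top).ne
  calc 2 ^ (-|σ|) * (1 / 4) ^ n * κ * v x ^ q * R ^ (α - σ)
      = volume.real (B \ {x}) * (v x ^ q * R ^ (α - (n : ℝ)) * (2 ^ (-|σ|) * R ^ (-σ))) := by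
        have hpow : R ^ (α - σ) = R ^ n * R ^ (α - (n : ℝ)) * R ^ (-σ) := by
          rw [← Real.rpow_natCast, ← Real.rpow_add hR0, ← Real.rpow_add hR0]
          ring_nf
        rw [hxB, hvol, hpow, div_pow, div_pow, one_pow]
        ring
    _ = ∫ _ in B \ {x}, v x ^ q * R ^ (α - (n : ℝ)) * (2 ^ (-|σ|) * R ^ (-σ)) := by
        rw [setIntegral_const, smul_eq_mul]
    _ ≤ ∫ y in B \ {x}, v y ^ q * ‖x - y‖ ^ (α - (n : ℝ)) * ‖y‖ ^ (-σ) :=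
        setIntegral_mono_on (integrableOn_const hBfin) hint.integrableOn
          (measurableSet_ball.diff (measurableSet_singleton x)) hlow
    _ ≤ _ := setIntegral_le_integral hint (Filter.Eventually.of_forall hnn)

/-- Coupled lower bounds with superlinear total exponent force power decay. -/
lemma exists_decay_of_coupled_lower_bounds {c d p q s t : ℝ} (hc : 0 < c) (hd : 0 < d)
    (hq : 0 < q) (hpq : 1 < p * q) :
    ∃ C : ℝ, 0 < C ∧ ∀ U V r : ℝ, 0 < U → 0 < V → 0 < r → c * V ^ q * r ^ s ≤ U →
      d * U ^ p * r ^ t ≤ V → U ≤ C * r ^ (-((s + q * t) / (p * q - 1))) := by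
  have hk : 0 < p * q - 1 := by linarith
  refine ⟨(c * d ^ q)⁻¹ ^ (p * q - 1)⁻¹, by positivity, fun U V r hU hV hr hUV hVU => ?_⟩
  have h1 : c * (d * U ^ p * r ^ t) ^ q * r ^ s ≤ U := by
    refine le_trans ?_ hUV
    gcongr
  have h2 : c * (d * U ^ p * r ^ t) ^ q * r ^ s =
      (c * d ^ q) * (U ^ (p * q - 1) * r ^ (s + q * t)) * U := by
    rw [Real.mul_rpow (by positivity) (by positivity), Real.mul_rpow (by positivity) (by positivity),
      ← Real.rpow_mul hU.le, ← Real.rpow_mul hr.le, Real.rpow_sub_one hU.ne', Real.rpow_add hr,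
      mul_comm q t]
    field_simp
  have h3 : (c * d ^ q) * (U ^ (p * q - 1) * r ^ (s + q * t)) ≤ 1 := by
    rw [h2] at h1
    exact le_of_mul_le_mul_right (by linarith) hU
  have h4 : U ^ (p * q - 1) ≤ (c * d ^ q)⁻¹ * r ^ (-(s + q * t)) := by
    rw [Real.rpow_neg hr.le, ← mul_inv, ← one_div, le_div_iff₀ (by positivity)]
    linarith
  have h5 := (Real.le_rpow_inv_iff_of_pos hU.le (by positivity) hk).2 h4
  rw [Real.mul_rpow (by positivity) (by positivity), ← Real.rpow_mul hr.le] at h5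
  convert h5 using 3
  ring

/-- The subcriticality condition makes the natural decay rate fast enough for finite energy. -/
lemma energy_exponent_of_subcritical {N α σ₁ σ₂ p q : ℝ} (hp : 0 < p) (hq : 0 < q)
    (hpq : 1 < p * q) (hsub : N - α < (N - σ₁) / (1 + q) + (N - σ₂) / (1 + p)) :
    N - σ₂ < ((α - σ₁) + q * (α - σ₂)) / (p * q - 1) * (p + 1) := by
  have hk : 0 < p * q - 1 := by linarith
  rw [div_add_div _ _ (by positivity) (by positivity), lt_div_iff₀ (by positivity)] at hsub
  rw [div_mul_eq_mul_div, lt_div_iff₀ hk]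
  nlinarith

theorem stmt_11 (n : ℕ) (hn : 3 ≤ n) (α σ₁ σ₂ p q : ℝ)
    (hα2 : 2 ≤ α) (hαn : α < n) (hσ₁ : σ₁ < α) (hσ₂ : σ₂ < α)
    (hp : 0 < p) (hq : 0 < q) (hpq : 1 < p * q)
    (hsub : (n : ℝ) - α < ((n : ℝ) - σ₁) / (1 + q) + ((n : ℝ) - σ₂) / (1 + p))
    (u v : EuclideanSpace ℝ (Fin n) → ℝ)
    (hupos : ∀ x, 0 < u x) (hvpos : ∀ x, 0 < v x)
    (hurad : RadiallyDecreasing u) (hvrad : RadiallyDecreasing v)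
    (hucont : Continuous u) (hvcont : Continuous v)
    (huC1 : ContDiffOn ℝ 1 u {(0 : EuclideanSpace ℝ (Fin n))}ᶜ)
    (hvC1 : ContDiffOn ℝ 1 v {(0 : EuclideanSpace ℝ (Fin n))}ᶜ)
    (hsol : ∀ x : EuclideanSpace ℝ (Fin n),
      Integrable (fun y => v y ^ q * ‖x - y‖ ^ (α - (n : ℝ)) * ‖y‖ ^ (-σ₁)) ∧
      Integrable (fun y => u y ^ p * ‖x - y‖ ^ (α - (n : ℝ)) * ‖y‖ ^ (-σ₂)) ∧
      u x = (∫ y, v y ^ q * ‖x - y‖ ^ (α - (n : ℝ)) * ‖y‖ ^ (-σ₁)) ∧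
      v x = (∫ y, u y ^ p * ‖x - y‖ ^ (α - (n : ℝ)) * ‖y‖ ^ (-σ₂))) :
    Integrable (fun x : EuclideanSpace ℝ (Fin n) => u x ^ (p + 1) * ‖x‖ ^ (-σ₂)) ∧
    Integrable (fun x : EuclideanSpace ℝ (Fin n) => v x ^ (q + 1) * ‖x‖ ^ (-σ₁)) ∧
    Integrable (fun x : EuclideanSpace ℝ (Fin n) =>
      u x ^ p * ‖x‖ ^ (-σ₂) * |⟪x, gradient u x⟫|) ∧
    Integrable (fun x : EuclideanSpace ℝ (Fin n) =>
      v x ^ q * ‖x‖ ^ (-σ₁) * |⟪x, gradient v x⟫|) := by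
  have hn1 : 1 ≤ n := by omega
  have hqp : 1 < q * p := by rwa [mul_comm]
  obtain ⟨c, hc, hcu⟩ := exists_riesz_potential_lower_bound hn1 α σ₁ q hαn hq
  obtain ⟨d, hd, hdv⟩ := exists_riesz_potential_lower_bound hn1 α σ₂ p hαn hp
  have hlu : ∀ x, x ≠ 0 → c * v x ^ q * ‖x‖ ^ (α - σ₁) ≤ u x := fun x hx => by
    obtain ⟨hi, -, he, -⟩ := hsol x
    rw [he]
    exact hcu v hvpos hvrad x hx hi
  have hlv : ∀ x, x ≠ 0 → d * u x ^ p * ‖x‖ ^ (α - σ₂) ≤ v x := fun x hx => by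
    obtain ⟨-, hi, -, he⟩ := hsol x
    rw [he]
    exact hdv u hupos hurad x hx hi
  obtain ⟨C, hC, hCu⟩ := exists_decay_of_coupled_lower_bounds (s := α - σ₁) (t := α - σ₂)
    hc hd hq hpq
  obtain ⟨D, hD, hDv⟩ := exists_decay_of_coupled_lower_bounds (s := α - σ₂) (t := α - σ₁)
    hd hc hp hqp
  obtain ⟨hu, hu'⟩ := hurad.integrable_energy hn1 hupos hucont
    (huC1.differentiableOn one_ne_zero) hp (hσ₂.trans hαn)
    (energy_exponent_of_subcritical hp hq hpq hsub) hC fun x hx =>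
      hCu _ _ _ (hupos x) (hvpos x) (norm_pos_iff.2 hx) (hlu x hx) (hlv x hx)
  obtain ⟨hv, hv'⟩ := hvrad.integrable_energy hn1 hvpos hvcont
    (hvC1.differentiableOn one_ne_zero) hq (hσ₁.trans hαn)
    (energy_exponent_of_subcritical hq hp hqp (by rwa [add_comm])) hD fun x hx =>
      hDv _ _ _ (hvpos x) (hupos x) (norm_pos_iff.2 hx) (hlv x hx) (hlu x hx)
  exact ⟨hu, hv, hu', hv'⟩
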